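/- Define W̃(x,y,t) = 4∫₀^{y₂}∫_ℝ Γ(x−z*,t) ∂²_{z₁}E(z−y) dz₁ dz₂ and η(y₂) = ∫₀^{y₂} ρ Γ₀(ρ,1) dρ + y₂ ∫_{y₂}^∞ Γ₀(ρ,1) dρ. There exists a constant C>0 such that for every y ∈ ℝ²₊, ∫_{ℝ²₊} |W̃(x,y,1)| dx ≤ C η(y₂). (The function η is bounded and continuous on [0,∞) with η(0)=0.) -/

import Mathlib

open MeasureTheory Real
open scoped ENNReal

noncomputable section

/-- The open upper half plane ℝ²₊ = {x : x₂ > 0}. -/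
def upperHalf : Set (ℝ × ℝ) := {x | 0 < x.2}

/-- 2D heat kernel Γ(x,t) = (4πt)⁻¹ exp(−|x|²/(4t)). -/
def heatK (x : ℝ × ℝ) (t : ℝ) : ℝ :=
  (4 * π * t)⁻¹ * Real.exp (-(x.1 ^ 2 + x.2 ^ 2) / (4 * t))

/-- 1D heat kernel Γ₀(r,t) = (4πt)^{-1/2} exp(−r²/(4t)). -/
def heatK1 (r t : ℝ) : ℝ :=
  (Real.sqrt (4 * π * t))⁻¹ * Real.exp (-r ^ 2 / (4 * t))

/-- ∂²_{z₁} E(z) = (z₁² − z₂²)/(2π|z|⁴), for E(z) = −(2π)⁻¹ log|z|. -/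
def d2E (z : ℝ × ℝ) : ℝ :=
  (z.1 ^ 2 - z.2 ^ 2) / (2 * π * (z.1 ^ 2 + z.2 ^ 2) ^ 2)

/-- Poisson kernel P_s(r) = s/(π(r²+s²)). -/
def Pker (s r : ℝ) : ℝ := s / (π * (r ^ 2 + s ^ 2))

/-- Conjugate Poisson kernel Q_s(r) = r/(π(r²+s²)). -/
def Qker (s r : ℝ) : ℝ := r / (π * (r ^ 2 + s ^ 2))

/-- ∇⊥E(z) = (∂₂E(z), −∂₁E(z)) for E(z) = −(2π)⁻¹ log|z|. -/
def gradPerpE (z : ℝ × ℝ) : ℝ × ℝ :=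
  (-z.2 / (2 * π * (z.1 ^ 2 + z.2 ^ 2)), z.1 / (2 * π * (z.1 ^ 2 + z.2 ^ 2)))

/-- The Biot–Savart kernel ∇⊥_x D(x,y) = ∇⊥E(x−y) − ∇⊥E(x−y*). -/
def bsKernel (x y : ℝ × ℝ) : ℝ × ℝ :=
  gradPerpE (x.1 - y.1, x.2 - y.2) - gradPerpE (x.1 - y.1, x.2 + y.2)

/-- Integral of a real function against a finite signed measure (via Jordan decomposition). -/
def sInt (μ : SignedMeasure (ℝ × ℝ)) (f : ℝ × ℝ → ℝ) : ℝ :=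
  (∫ y, f y ∂μ.toJordanDecomposition.posPart) - ∫ y, f y ∂μ.toJordanDecomposition.negPart

/-- Integral of a vector-valued function against a finite signed measure. -/
def sIntV (μ : SignedMeasure (ℝ × ℝ)) (f : ℝ × ℝ → ℝ × ℝ) : ℝ × ℝ :=
  (∫ y, f y ∂μ.toJordanDecomposition.posPart) - ∫ y, f y ∂μ.toJordanDecomposition.negPart

/-- Total variation norm ‖μ‖_M of a finite signed measure. -/
def normM (μ : SignedMeasure (ℝ × ℝ)) : ℝ := (μ.totalVariation Set.univ).toReal

/-- The vorticity kernel W(x,y,t). -/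
def Wk (x y : ℝ × ℝ) (t : ℝ) : ℝ :=
  heatK (x.1 - y.1, x.2 - y.2) t + heatK (x.1 - y.1, x.2 + y.2) t
    + 4 * ∫ z₂ in (0:ℝ)..y.2, ∫ z₁ : ℝ, heatK (x.1 - z₁, x.2 + z₂) t * d2E (z₁ - y.1, z₂ - y.2)
    - 2 * heatK1 x.2 t * ∫ z₁ : ℝ, heatK1 (x.1 - z₁) t * Pker y.2 (z₁ - y.1)

/-- T(t)ω₀(x) = ∫ W(x,y,t) dω₀(y) for a finite signed measure ω₀. -/
def Tsg (ω₀ : SignedMeasure (ℝ × ℝ)) (t : ℝ) (x : ℝ × ℝ) : ℝ :=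
  sInt ω₀ (fun y => Wk x y t)

/-- The boundary trace operator T₁μ(x₁) = π⁻¹ ∫ y₂/((x₁−y₁)²+y₂²) dμ(y). -/
def T1op (μ : SignedMeasure (ℝ × ℝ)) (x₁ : ℝ) : ℝ :=
  π⁻¹ * sInt μ (fun y => y.2 / ((x₁ - y.1) ^ 2 + y.2 ^ 2))

/-- W̃(x,y,t) = 4∫₀^{y₂}∫_ℝ Γ(x−z*,t) ∂²_{z₁}E(z−y) dz. -/
def Wtil (x y : ℝ × ℝ) (t : ℝ) : ℝ :=
  4 * ∫ z₂ in (0:ℝ)..y.2, ∫ z₁ : ℝ, heatK (x.1 - z₁, x.2 + z₂) t * d2E (z₁ - y.1, z₂ - y.2)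

/-- η(r) = ∫₀^r ρΓ₀(ρ,1) dρ + r ∫_r^∞ Γ₀(ρ,1) dρ. -/
def eta (r : ℝ) : ℝ :=
  (∫ ρ in (0:ℝ)..r, ρ * heatK1 ρ 1) + r * ∫ ρ in Set.Ioi r, heatK1 ρ 1

lemma heatK1_one (r : ℝ) : heatK1 r 1 = (√(4 * π))⁻¹ * Real.exp (-(1 / 4) * r ^ 2) := by
  unfold heatK1
  rw [mul_one]
  congr 2
  ring

lemma heatK1_one_nonneg (r : ℝ) : 0 ≤ heatK1 r 1 := by
  rw [heatK1_one]; positivity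

lemma continuous_heatK1_one : Continuous fun r => heatK1 r 1 := by
  simp_rw [heatK1_one]; fun_prop

lemma integrable_heatK1_one : Integrable fun r => heatK1 r 1 := by
  simp_rw [heatK1_one]
  exact (integrable_exp_neg_mul_sq (by norm_num)).const_mul _

lemma integrable_mul_heatK1_one : Integrable fun r => r * heatK1 r 1 := by
  simp_rw [heatK1_one, mul_left_comm _ (√(4 * π))⁻¹]
  exact (integrable_mul_exp_neg_mul_sq (by norm_num)).const_mul _

lemma heatK_one (a b : ℝ) : heatK (a, b) 1 = heatK1 b 1 * heatK1 a 1 := by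
  rw [heatK1_one, heatK1_one, mul_mul_mul_comm, ← Real.exp_add, ← mul_inv,
    Real.mul_self_sqrt (by positivity)]
  unfold heatK
  rw [mul_one]
  congr 2
  ring

lemma hasDerivAt_integral_Ioi_heatK1 (r : ℝ) :
    HasDerivAt (fun r => ∫ ρ in Set.Ioi r, heatK1 ρ 1) (-heatK1 r 1) r := by
  have h : (fun r => ∫ ρ in Set.Ioi r, heatK1 ρ 1) =
      fun r => (∫ ρ in Set.Ioi (0 : ℝ), heatK1 ρ 1) - ∫ ρ in (0 : ℝ)..r, heatK1 ρ 1 := by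
    funext r
    rw [← intervalIntegral.integral_interval_add_Ioi (a := 0) integrable_heatK1_one.integrableOn
      (integrable_heatK1_one.integrableOn (s := Set.Ioi r)), add_sub_cancel_left]
  rw [h]
  exact (continuous_heatK1_one.integral_hasStrictDerivAt 0 r).hasDerivAt.const_sub _

lemma continuous_integral_Ioi_heatK1 : Continuous fun r => ∫ ρ in Set.Ioi r, heatK1 ρ 1 :=
  continuous_iff_continuousAt.2 fun r => (hasDerivAt_integral_Ioi_heatK1 r).continuousAt

lemma hasDerivAt_eta (r : ℝ) : HasDerivAt eta (∫ ρ in Set.Ioi r, heatK1 ρ 1) r := by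
  have h := ((continuous_id.mul continuous_heatK1_one).integral_hasStrictDerivAt
    0 r).hasDerivAt.add ((hasDerivAt_id r).mul (hasDerivAt_integral_Ioi_heatK1 r))
  refine h.congr_deriv ?_
  simp

lemma eta_zero : eta 0 = 0 := by simp [eta]

lemma eta_le (r : ℝ) : eta r ≤ ∫ ρ in Set.Ioi (0 : ℝ), ρ * heatK1 ρ 1 := by
  rw [← intervalIntegral.integral_interval_add_Ioi integrable_mul_heatK1_one.integrableOn
      (integrable_mul_heatK1_one.integrableOn (s := Set.Ioi r)), eta, ← integral_const_mul]
  refine add_le_add_right ?_ _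
  refine setIntegral_mono_on (integrable_heatK1_one.integrableOn.const_mul r)
    integrable_mul_heatK1_one.integrableOn measurableSet_Ioi fun ρ hρ => ?_
  exact mul_le_mul_of_nonneg_right (Set.mem_Ioi.1 hρ).le (heatK1_one_nonneg ρ)

lemma eta_eq_integral (r : ℝ) : eta r = ∫ z in (0 : ℝ)..r, ∫ ρ in Set.Ioi z, heatK1 ρ 1 := by
  rw [intervalIntegral.integral_eq_sub_of_hasDerivAt (fun x _ => hasDerivAt_eta x)
    (continuous_integral_Ioi_heatK1.intervalIntegrable _ _), eta_zero, sub_zero]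

lemma lintegral_Ioi_heatK1_add (z : ℝ) :
    ∫⁻ x in Set.Ioi (0 : ℝ), ENNReal.ofReal (heatK1 (x + z) 1) =
      ENNReal.ofReal (∫ ρ in Set.Ioi z, heatK1 ρ 1) := by
  have h := (measurePreserving_add_right (volume : Measure ℝ) z).setLIntegral_comp_preimage
    (measurableSet_Ioi (a := z)) continuous_heatK1_one.measurable.ennreal_ofReal
  rw [Set.preimage_add_const_Ioi, sub_self] at h
  rw [h, ofReal_integral_eq_lintegral_ofReal integrable_heatK1_one.integrableOn
    (Filter.Eventually.of_forall heatK1_one_nonneg)]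

lemma lintegral_lintegral_heatK1_add {r : ℝ} (hr : 0 ≤ r) :
    ∫⁻ x in Set.Ioi (0 : ℝ), ∫⁻ z in Set.Ioc 0 r, ENNReal.ofReal (heatK1 (x + z) 1) =
      ENNReal.ofReal (eta r) := by
  rw [lintegral_lintegral_swap]
  · simp_rw [lintegral_Ioi_heatK1_add]
    rw [← ofReal_integral_eq_lintegral_ofReal, eta_eq_integral,
      intervalIntegral.integral_of_le hr]
    · exact (continuous_integral_Ioi_heatK1.intervalIntegrable 0 r).1
    · exact Filter.Eventually.of_forall fun z => integral_nonneg heatK1_one_nonneg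
  · exact ((continuous_heatK1_one.comp continuous_add).measurable.ennreal_ofReal).aemeasurable

lemma abs_sq_sub_sq_le (z s : ℝ) : |z ^ 2 - s ^ 2| ≤ z ^ 2 + s ^ 2 :=
  abs_le.2 ⟨by linarith [sq_nonneg z], by linarith [sq_nonneg s]⟩

lemma abs_d2E_le_of_left {z : ℝ} (hz : z ≠ 0) (s : ℝ) : |d2E (z, s)| ≤ (2 * π * z ^ 2)⁻¹ := by
  have hz2 : 0 < z ^ 2 := by positivity
  simp only [d2E]
  rw [abs_div, abs_of_nonneg (a := 2 * π * _) (by positivity), div_le_iff₀ (by positivity)]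
  rw [show (2 * π * z ^ 2)⁻¹ * (2 * π * (z ^ 2 + s ^ 2) ^ 2) =
    (z ^ 2 + s ^ 2) * ((z ^ 2 + s ^ 2) / z ^ 2) by field_simp]
  refine (abs_sq_sub_sq_le z s).trans (le_mul_of_one_le_right (by positivity) ?_)
  rw [one_le_div hz2]
  nlinarith [sq_nonneg s]

lemma hasDerivAt_d2E {s : ℝ} (hs : s ≠ 0) (z : ℝ) :
    HasDerivAt (fun z => -z / (2 * π * (z ^ 2 + s ^ 2))) (d2E (z, s)) z := by
  have hp : z ^ 2 + s ^ 2 ≠ 0 := by positivity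
  have h := (hasDerivAt_id z).neg.div
    ((((hasDerivAt_id z).pow 2).add_const (s ^ 2)).const_mul (2 * π)) (by simp; exact hp)
  refine h.congr_deriv ?_
  simp only [d2E, id]
  simp
  field_simp
  ring

lemma continuous_d2E_left {s : ℝ} (hs : s ≠ 0) : Continuous fun z => d2E (z, s) := by
  simp only [d2E]
  exact Continuous.div (by fun_prop) (by fun_prop) fun z => by positivity

lemma integrable_d2E_left {s : ℝ} (hs : s ≠ 0) : Integrable fun z => d2E (z, s) := by
  have hb := (integrable_inv_one_add_sq.comp_div hs).const_mul ((2 * π * s ^ 2)⁻¹)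
  refine hb.mono' (continuous_d2E_left hs).aestronglyMeasurable
    (Filter.Eventually.of_forall fun z => ?_)
  have hs2 : 0 < s ^ 2 := by positivity
  simp only [d2E]
  rw [Real.norm_eq_abs, abs_div, abs_of_nonneg (a := 2 * π * _) (by positivity),
    div_le_iff₀ (by positivity)]
  rw [show (2 * π * s ^ 2)⁻¹ * (1 + (z / s) ^ 2)⁻¹ * (2 * π * (z ^ 2 + s ^ 2) ^ 2) =
    z ^ 2 + s ^ 2 by field_simp; ring]
  exact abs_sq_sub_sq_le z s

lemma integral_d2E_left {s : ℝ} (hs : s ≠ 0) : ∫ z, d2E (z, s) = 0 := by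
  have key : Filter.Tendsto (fun z : ℝ => -z / (2 * π * (z ^ 2 + s ^ 2)))
      (Filter.cocompact ℝ) (nhds 0) := by
    have h0 : Filter.Tendsto (fun z : ℝ => (2 * π)⁻¹ * ‖z⁻¹‖) (Filter.cocompact ℝ) (nhds 0) := by
      simpa using (Filter.tendsto_inv₀_cobounded (α := ℝ)).norm.const_mul ((2 * π)⁻¹)
    refine squeeze_zero_norm (fun z => ?_) h0
    rcases eq_or_ne z 0 with rfl | hz
    · simp
    have hz' : 0 < |z| := abs_pos.2 hz
    rw [norm_div, norm_neg, norm_inv, Real.norm_eq_abs, Real.norm_eq_abs,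
      abs_of_nonneg (a := 2 * π * _) (by positivity), div_le_iff₀ (by positivity), ← sq_abs z]
    rw [show (2 * π)⁻¹ * |z|⁻¹ * (2 * π * (|z| ^ 2 + s ^ 2)) = |z| + s ^ 2 / |z| by field_simp]
    have : 0 ≤ s ^ 2 / |z| := by positivity
    linarith
  rw [integral_of_hasDerivAt_of_tendsto (hasDerivAt_d2E hs) (integrable_d2E_left hs)
    (key.mono_left atBot_le_cocompact) (key.mono_left atTop_le_cocompact), sub_zero]


/-- The second difference of the 1D heat kernel at time 1. -/
def heatSecondDiff (u z : ℝ) : ℝ := heatK1 (u + z) 1 + heatK1 (u - z) 1 - 2 * heatK1 u 1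

lemma continuous_heatSecondDiff : Continuous fun p : ℝ × ℝ => heatSecondDiff p.1 p.2 := by
  simp only [heatSecondDiff, heatK1_one]
  fun_prop

lemma heatSecondDiff_eq (u z : ℝ) : heatSecondDiff u z =
    2 * (√(4 * π))⁻¹ * (Real.exp (-(1 / 4) * u ^ 2) *
      (Real.exp (-(1 / 4) * z ^ 2) * Real.cosh (u * z / 2) - 1)) := by
  simp only [heatSecondDiff, heatK1_one, Real.cosh_eq]
  rw [show -(1 / 4) * (u + z) ^ 2 = -(1 / 4) * u ^ 2 + -(1 / 4) * z ^ 2 + -(u * z / 2) by ring,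
    show -(1 / 4) * (u - z) ^ 2 = -(1 / 4) * u ^ 2 + -(1 / 4) * z ^ 2 + u * z / 2 by ring]
  simp only [Real.exp_add]
  ring

/-- The inequality `exp t - 1 ≤ t * exp t`. -/
lemma exp_sub_one_le_mul_exp (t : ℝ) : Real.exp t - 1 ≤ t * Real.exp t := by
  have h := mul_le_mul_of_nonneg_right (Real.add_one_le_exp (-t)) (Real.exp_pos t).le
  rw [← Real.exp_add, neg_add_cancel, Real.exp_zero] at h
  linarith

lemma abs_heatSecondDiff_le {z : ℝ} (hz : z ^ 2 ≤ 1) (u : ℝ) :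
    |heatSecondDiff u z| ≤ z ^ 2 * (5 * (√(4 * π))⁻¹ * Real.exp (-(1 / 16) * u ^ 2)) := by
  have hlow : -(z ^ 2 / 4) ≤ Real.exp (-(1 / 4) * z ^ 2) * Real.cosh (u * z / 2) - 1 := by
    have h1 := Real.add_one_le_exp (-(1 / 4) * z ^ 2)
    have h2 := le_mul_of_one_le_right (Real.exp_pos (-(1 / 4) * z ^ 2)).le
      (Real.one_le_cosh (u * z / 2))
    linarith
  have hup : Real.exp (-(1 / 4) * z ^ 2) * Real.cosh (u * z / 2) - 1 ≤
      z ^ 2 * (u ^ 2 / 8 * Real.exp (u ^ 2 / 8)) := by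
    have h1 : Real.exp (-(1 / 4) * z ^ 2) * Real.cosh (u * z / 2) ≤ Real.cosh (u * z / 2) :=
      mul_le_of_le_one_left (Real.cosh_pos _).le
        (Real.exp_le_one_iff.2 (by nlinarith [sq_nonneg z]))
    have h2 := Real.cosh_le_exp_half_sq (u * z / 2)
    rw [show (u * z / 2) ^ 2 / 2 = u ^ 2 / 8 * z ^ 2 by ring] at h2
    have h3 := exp_sub_one_le_mul_exp (u ^ 2 / 8 * z ^ 2)
    have h4 : Real.exp (u ^ 2 / 8 * z ^ 2) ≤ Real.exp (u ^ 2 / 8) :=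
      Real.exp_le_exp.2 (mul_le_of_le_one_right (by positivity) hz)
    have h5 := mul_le_mul_of_nonneg_left h4 (by positivity : 0 ≤ u ^ 2 / 8 * z ^ 2)
    linarith
  have hexp : u ^ 2 / 8 * Real.exp (u ^ 2 / 8) ≤ 2 * Real.exp (3 / 16 * u ^ 2) := by
    have h1 := Real.add_one_le_exp (u ^ 2 / 16)
    rw [show 3 / 16 * u ^ 2 = u ^ 2 / 16 + u ^ 2 / 8 by ring, Real.exp_add, ← mul_assoc]
    exact mul_le_mul_of_nonneg_right (by linarith) (Real.exp_pos _).le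
  have hone : 1 ≤ Real.exp (3 / 16 * u ^ 2) := Real.one_le_exp (by positivity)
  have habs : |Real.exp (-(1 / 4) * z ^ 2) * Real.cosh (u * z / 2) - 1| ≤
      z ^ 2 * (5 / 2 * Real.exp (3 / 16 * u ^ 2)) := by
    have hz0 := sq_nonneg z
    refine abs_le.2 ⟨?_, ?_⟩ <;> nlinarith
  rw [heatSecondDiff_eq, abs_mul, abs_mul (Real.exp _), Real.abs_exp,
    abs_of_nonneg (by positivity : 0 ≤ 2 * (√(4 * π))⁻¹)]
  refine (mul_le_mul_of_nonneg_left (mul_le_mul_of_nonneg_left habs (Real.exp_pos _).le)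
    (by positivity)).trans_eq ?_
  rw [show -(1 / 16) * u ^ 2 = -(1 / 4) * u ^ 2 + 3 / 16 * u ^ 2 by ring, Real.exp_add]
  ring

lemma exists_lintegral_heatSecondDiff_le :
    ∃ C : ℝ, 0 ≤ C ∧ ∀ z,
      ∫⁻ u, ‖heatSecondDiff u z‖ₑ ≤ ENNReal.ofReal (C * (z ^ 2 / (1 + z ^ 2))) := by
  set A : ℝ := ∫ u, 5 * (√(4 * π))⁻¹ * Real.exp (-(1 / 16) * u ^ 2) with hA
  set B : ℝ := 4 * ∫ u, heatK1 u 1 with hB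
  have hA0 : 0 ≤ A := integral_nonneg fun u => by positivity
  have hB0 : 0 ≤ B := mul_nonneg (by norm_num) (integral_nonneg heatK1_one_nonneg)
  have hgauss : Integrable fun u : ℝ => 5 * (√(4 * π))⁻¹ * Real.exp (-(1 / 16) * u ^ 2) :=
    (integrable_exp_neg_mul_sq (by norm_num)).const_mul _
  have h1 (z : ℝ) : Integrable fun u => heatK1 (u + z) 1 := integrable_heatK1_one.comp_add_right z
  have h2 (z : ℝ) : Integrable fun u => heatK1 (u - z) 1 := integrable_heatK1_one.comp_sub_right z
  have h3 : Integrable fun u => 2 * heatK1 u 1 := integrable_heatK1_one.const_mul 2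
  refine ⟨2 * A + 2 * B, by positivity, fun z => ?_⟩
  have hint : Integrable fun u => heatSecondDiff u z := ((h1 z).add (h2 z)).sub h3
  rw [← ofReal_integral_norm_eq_lintegral_enorm hint]
  refine ENNReal.ofReal_le_ofReal ?_
  rw [← mul_div_assoc, le_div_iff₀ (by positivity)]
  rcases le_total (z ^ 2) 1 with hz | hz
  · have h : ∫ u, ‖heatSecondDiff u z‖ ≤ z ^ 2 * A := by
      rw [hA, ← integral_const_mul]
      exact integral_mono hint.norm (hgauss.const_mul _) (abs_heatSecondDiff_le hz)
    nlinarith [mul_nonneg (sq_nonneg z) hA0, mul_nonneg (sq_nonneg z) hB0]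
  · have h : ∫ u, ‖heatSecondDiff u z‖ ≤ B := by
      have hs : ∫ u, (heatK1 (u + z) 1 + heatK1 (u - z) 1 + 2 * heatK1 u 1) = B := by
        have h12 : Integrable fun u => heatK1 (u + z) 1 + heatK1 (u - z) 1 := (h1 z).add (h2 z)
        rw [integral_add h12 h3, integral_add (h1 z) (h2 z),
          integral_add_right_eq_self (fun u => heatK1 u 1),
          integral_sub_right_eq_self (fun u => heatK1 u 1), integral_const_mul, hB]
        ring
      rw [← hs]
      refine integral_mono hint.norm (((h1 z).add (h2 z)).add h3) fun u => abs_le.2 ⟨?_, ?_⟩ <;>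
      · simp only [heatSecondDiff]
        linarith [heatK1_one_nonneg (u + z), heatK1_one_nonneg (u - z), heatK1_one_nonneg u]
    nlinarith [mul_nonneg (sq_nonneg z) hA0]

/-- A majorant, uniform in `s ≠ 0`, of the convolution of the 1D heat kernel with
`z ↦ d2E (z, s)`. -/
def convMajorant (u : ℝ) : ℝ≥0∞ :=
  ∫⁻ z, ‖heatSecondDiff u z‖ₑ * ENNReal.ofReal (4 * π * z ^ 2)⁻¹

lemma measurable_convMajorant_integrand : Measurable fun p : ℝ × ℝ =>
    ‖heatSecondDiff p.1 p.2‖ₑ * ENNReal.ofReal (4 * π * p.2 ^ 2)⁻¹ :=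
  continuous_heatSecondDiff.measurable.enorm.mul (by fun_prop)

lemma measurable_convMajorant : Measurable convMajorant :=
  measurable_convMajorant_integrand.lintegral_prod_right'

lemma lintegral_convMajorant_lt_top : ∫⁻ u, convMajorant u < ∞ := by
  obtain ⟨C, hC0, hC⟩ := exists_lintegral_heatSecondDiff_le
  unfold convMajorant
  rw [lintegral_lintegral_swap measurable_convMajorant_integrand.aemeasurable]
  have hint : Integrable fun z : ℝ => C * (4 * π)⁻¹ * (1 + z ^ 2)⁻¹ :=
    integrable_inv_one_add_sq.const_mul _
  refine lt_of_le_of_lt (lintegral_mono fun z => ?_) hint.lintegral_lt_top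
  rw [lintegral_mul_const' _ _ ENNReal.ofReal_ne_top]
  refine (mul_le_mul_left (hC z) _).trans ?_
  rw [← ENNReal.ofReal_mul (by positivity)]
  refine ENNReal.ofReal_le_ofReal ?_
  rcases eq_or_ne z 0 with rfl | hz
  · simp; positivity
  · apply le_of_eq
    field_simp

lemma integral_heatK1_mul_d2E {s : ℝ} (hs : s ≠ 0) (u : ℝ) :
    ∫ z, heatK1 (u - z) 1 * d2E (z, s) = 2⁻¹ * ∫ z, heatSecondDiff u z * d2E (z, s) := by
  have hb (r : ℝ) : ‖heatK1 r 1‖ ≤ (√(4 * π))⁻¹ := by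
    rw [Real.norm_of_nonneg (heatK1_one_nonneg r), heatK1_one]
    exact mul_le_of_le_one_right (by positivity)
      (Real.exp_le_one_iff.2 (by nlinarith [sq_nonneg r]))
  have hi {f : ℝ → ℝ} (hf : Continuous f) : Integrable fun z => heatK1 (f z) 1 * d2E (z, s) :=
    (integrable_d2E_left hs).bdd_mul (continuous_heatK1_one.comp hf).aestronglyMeasurable
      (Filter.Eventually.of_forall fun z => hb (f z))
  have hneg : ∫ z, heatK1 (u + z) 1 * d2E (z, s) = ∫ z, heatK1 (u - z) 1 * d2E (z, s) := by
    rw [← integral_neg_eq_self]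
    simp [d2E, sub_eq_add_neg]
  have hzero : ∫ z, 2 * heatK1 u 1 * d2E (z, s) = 0 := by
    rw [integral_const_mul, integral_d2E_left hs, mul_zero]
  simp only [heatSecondDiff, sub_mul (heatK1 _ 1 + _), add_mul]
  have h1 : Integrable fun z => heatK1 (u + z) 1 * d2E (z, s) := hi (by fun_prop)
  have h2 : Integrable fun z => heatK1 (u - z) 1 * d2E (z, s) := hi (by fun_prop)
  have h3 : Integrable fun z => 2 * heatK1 u 1 * d2E (z, s) :=
    (integrable_d2E_left hs).const_mul _
  have h12 : Integrable fun z => heatK1 (u + z) 1 * d2E (z, s) + heatK1 (u - z) 1 * d2E (z, s) :=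
    h1.add h2
  rw [integral_sub h12 h3, integral_add h1 h2, hneg, hzero]
  ring

lemma enorm_integral_heatK1_mul_d2E_le {s : ℝ} (hs : s ≠ 0) (u : ℝ) :
    ‖∫ z, heatK1 (u - z) 1 * d2E (z, s)‖ₑ ≤ convMajorant u := by
  rw [integral_heatK1_mul_d2E hs, ← integral_const_mul]
  refine (enorm_integral_le_lintegral_enorm _).trans (lintegral_mono fun z => ?_)
  rcases eq_or_ne z 0 with rfl | hz
  · simp [heatSecondDiff, two_mul]
  rw [mul_left_comm, enorm_mul]
  refine mul_le_mul_right ?_ _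
  rw [← ofReal_norm, Real.norm_eq_abs, abs_mul, abs_of_pos (by norm_num : (0 : ℝ) < 2⁻¹)]
  refine ENNReal.ofReal_le_ofReal ?_
  refine (mul_le_mul_of_nonneg_left (abs_d2E_le_of_left hz s) (by norm_num)).trans_eq ?_
  rw [← mul_inv]
  ring

lemma integral_heatK_mul_d2E (a b c s : ℝ) :
    ∫ z, heatK (a - z, b) 1 * d2E (z - c, s) =
      heatK1 b 1 * ∫ z, heatK1 (a - c - z) 1 * d2E (z, s) := by
  rw [← integral_const_mul,
    ← integral_sub_right_eq_self (fun z => heatK1 b 1 * (heatK1 (a - c - z) 1 * d2E (z, s))) c]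
  simp only [heatK_one, sub_sub_sub_cancel_right, mul_assoc]

lemma enorm_Wtil_le (x : ℝ × ℝ) {y : ℝ × ℝ} (hy : 0 ≤ y.2) :
    ‖Wtil x y 1‖ₑ ≤ 4 * (convMajorant (x.1 - y.1) *
      ∫⁻ z in Set.Ioc 0 y.2, ENNReal.ofReal (heatK1 (x.2 + z) 1)) := by
  rw [Wtil, enorm_mul, intervalIntegral.integral_of_le hy]
  refine mul_le_mul' (by simp [Real.enorm_eq_ofReal]) ?_
  refine (enorm_integral_le_lintegral_enorm _).trans ?_
  have hm : Measurable fun z => ENNReal.ofReal (heatK1 (x.2 + z) 1) :=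
    continuous_heatK1_one.measurable.ennreal_ofReal.comp (measurable_const_add x.2)
  rw [← lintegral_const_mul _ hm]
  refine lintegral_mono_ae ?_
  filter_upwards [ae_restrict_of_ae (Measure.ae_ne volume y.2)] with z hz
  rw [integral_heatK_mul_d2E, enorm_mul, mul_comm, Real.enorm_eq_ofReal (heatK1_one_nonneg _)]
  exact mul_le_mul_left (enorm_integral_heatK1_mul_d2E_le (sub_ne_zero.2 hz) _) _

lemma lintegral_enorm_Wtil_le {y : ℝ × ℝ} (hy : 0 ≤ y.2) :
    ∫⁻ x in upperHalf, ‖Wtil x y 1‖ₑ ≤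
      4 * ((∫⁻ u, convMajorant u) * ENNReal.ofReal (eta y.2)) := by
  have hU : upperHalf = Set.univ ×ˢ Set.Ioi (0 : ℝ) := by
    ext x
    simp [upperHalf]
  have hm : Measurable fun b => ∫⁻ z in Set.Ioc 0 y.2, ENNReal.ofReal (heatK1 (b + z) 1) :=
    ((continuous_heatK1_one.comp continuous_add).measurable.ennreal_ofReal).lintegral_prod_right'
  refine (lintegral_mono fun x => enorm_Wtil_le x hy).trans_eq ?_
  rw [lintegral_const_mul' _ _ (by norm_num), hU, Measure.volume_eq_prod, ← Measure.prod_restrict,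
    Measure.restrict_univ, lintegral_prod_mul (f := fun a => convMajorant (a - y.1))
      (measurable_convMajorant.comp (measurable_sub_const y.1)).aemeasurable hm.aemeasurable,
    lintegral_lintegral_heatK1_add hy, lintegral_sub_right_eq_self]

/-- η is bounded and continuous on [0,∞) with η(0) = 0, and there is C > 0 with
∫_{ℝ²₊} |W̃(x,y,1)| dx ≤ C η(y₂) for every y ∈ ℝ²₊. -/
theorem Wtil_L1_bound :
    Continuous eta ∧ (∃ M : ℝ, ∀ r : ℝ, 0 ≤ r → eta r ≤ M) ∧ eta 0 = 0 ∧
    ∃ C > (0:ℝ), ∀ y ∈ upperHalf,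
      (∫ x in upperHalf, |Wtil x y 1|) ≤ C * eta y.2 := by
  refine ⟨continuous_iff_continuousAt.2 fun r => (hasDerivAt_eta r).continuousAt,
    ⟨_, fun r _ => eta_le r⟩, eta_zero, 4 * (∫⁻ u, convMajorant u).toReal + 1, by positivity,
    fun y hy => ?_⟩
  have hy' : 0 ≤ y.2 := le_of_lt hy
  have hη : 0 ≤ eta y.2 := by
    rw [eta_eq_integral]
    exact intervalIntegral.integral_nonneg hy' fun z _ => integral_nonneg heatK1_one_nonneg
  have h := (enorm_integral_le_lintegral_enorm (μ := volume.restrict upperHalf)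
    fun x => |Wtil x y 1|).trans ((lintegral_mono fun x => (enorm_abs _).le).trans
      (lintegral_enorm_Wtil_le hy'))
  rw [← ENNReal.ofReal_toReal lintegral_convMajorant_lt_top.ne,
    ← ENNReal.ofReal_mul ENNReal.toReal_nonneg, ← ENNReal.ofReal_ofNat 4,
    ← ENNReal.ofReal_mul (by norm_num), Real.enorm_eq_ofReal (integral_nonneg fun _ => abs_nonneg _),
    ENNReal.ofReal_le_ofReal_iff (by positivity)] at h
  linarith

end
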